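/- For every point-shift F: the map F_ω is injective on ω for μ-almost every ω if and only if F_ω is surjective onto ω for μ-almost every ω; and in either case F_ω is a bijection of ω for μ-almost every ω. -/

import Mathlib

open Function Set MeasureTheory ProbabilityTheory
open scoped ENNReal NNReal

namespace PointShift

/-- Points of the grid `ℤ^d`. -/
abbrev Pt (d : ℕ) := Fin d → ℤ

/-- Configurations: subsets of the grid `ℤ^d`, identified with `{0,1}`-valued
functions, equipped with the product σ-algebra. -/
abbrev Conf (d : ℕ) := Pt d → Bool

/-- The shift `θ_t ω = ω - t`. -/
def shift {d : ℕ} (t : Pt d) (ω : Conf d) : Conf d := fun x => ω (x + t)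

/-- The support of a configuration, as a subset of `ℤ^d`. -/
def pts {d : ℕ} (ω : Conf d) : Set (Pt d) := {x | ω x = true}

/-- `g` is a point-map: it is measurable and selects a point of every
configuration having a point at the origin. -/
def IsPointMap {d : ℕ} (g : Conf d → Pt d) : Prop :=
  Measurable g ∧ ∀ ω : Conf d, ω 0 = true → ω (g ω) = true

/-- The point-shift associated with a point-map `g`: `F_ω x = x + g (θ_x ω)`. -/
def Fps {d : ℕ} (g : Conf d → Pt d) (ω : Conf d) (x : Pt d) : Pt d :=
  x + g (shift x ω)

/-- `μ` is a stationary point process on the grid: a shift-invariant probability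
measure with a point at the origin with positive probability. -/
def IsStationaryPP {d : ℕ} (μ : Measure (Conf d)) : Prop :=
  IsProbabilityMeasure μ ∧ (∀ t : Pt d, μ.map (shift t) = μ) ∧
    0 < μ {ω : Conf d | ω 0 = true}

/-- The Palm probability of `μ`: `μ` conditioned on having a point at the origin. -/
noncomputable def Palm {d : ℕ} (μ : Measure (Conf d)) : Measure (Conf d) :=
  μ[|{ω : Conf d | ω 0 = true}]

/-- The foil of the point `x` in the configuration `ω`, for the point-shift of `g`. -/
def foilOn {d : ℕ} (g : Conf d → Pt d) (ω : Conf d) (x : Pt d) : Set (Pt d) :=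
  {y | ω y = true ∧ ∃ n : ℕ, (Fps g ω)^[n] y = (Fps g ω)^[n] x}

/-- The connected component of the point `x` in the functional graph `G^F(ω)`. -/
def compOn {d : ℕ} (g : Conf d → Pt d) (ω : Conf d) (x : Pt d) : Set (Pt d) :=
  {y | ω y = true ∧ ∃ m n : ℕ, (Fps g ω)^[m] x = (Fps g ω)^[n] y}

/-- `K` is a directed cycle of the functional graph of `f`: a finite set of
distinct points `c 0, …, c (k-1)` (with `k ≥ 1`) such that `f (c i) = c ((i+1) % k)`. -/
def IsCycle {X : Type*} (f : X → X) (K : Set X) : Prop :=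
  ∃ (k : ℕ) (c : ℕ → X), 0 < k ∧
    (∀ i < k, ∀ j < k, c i = c j → i = j) ∧
    (∀ i < k, f (c i) = c ((i + 1) % k)) ∧
    K = c '' {i | i < k}

end PointShift

namespace PointShift

variable {d : ℕ}

/-- The preimages of the point `y` under the point-shift of `g`. -/
def preimages (g : Conf d → Pt d) (ω : Conf d) (y : Pt d) : Set (Pt d) :=
  {x | ω x = true ∧ Fps g ω x = y}

/-- The number of preimages of the origin under the point-shift of `g`. -/
noncomputable def inDegree (g : Conf d → Pt d) (ω : Conf d) : ℝ≥0∞ :=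
  ∑' x : Pt d, {ω : Conf d | ω x = true ∧ Fps g ω x = 0}.indicator 1 ω

theorem measurable_shift (t : Pt d) : Measurable (shift t : Conf d → Conf d) :=
  measurable_pi_iff.mpr fun x => measurable_pi_apply (x + t)

theorem shift_shift (s t : Pt d) (ω : Conf d) : shift s (shift t ω) = shift (s + t) ω := by
  funext x
  simp [shift, add_assoc]

theorem Fps_shift (g : Conf d → Pt d) (ω : Conf d) (t x : Pt d) :
    Fps g (shift t ω) x = Fps g ω (x + t) - t := by
  simp only [Fps, shift_shift]
  abel

theorem mapsTo_Fps {g : Conf d → Pt d} (hg : IsPointMap g) (ω : Conf d) :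
    MapsTo (Fps g ω) (pts ω) (pts ω) := by
  intro x hx
  have h := hg.2 (shift x ω) (by simpa [shift, pts] using hx)
  simpa [shift, pts, Fps, add_comm] using h

theorem inDegree_eq_encard (g : Conf d → Pt d) (ω : Conf d) :
    inDegree g ω = ((preimages g ω 0).encard : ℝ≥0∞) := by
  rw [← ENNReal.tsum_set_one, tsum_subtype (preimages g ω 0) (fun _ => (1 : ℝ≥0∞))]
  rfl

theorem preimages_shift (g : Conf d → Pt d) (ω : Conf d) (y : Pt d) :
    preimages g (shift y ω) 0 = (· + y) ⁻¹' preimages g ω y := by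
  ext x
  simp [preimages, Fps_shift, sub_eq_zero, shift]

theorem measurableSet_origin : MeasurableSet {ω : Conf d | ω 0 = true} :=
  measurableSet_eq_fun (measurable_pi_apply (0 : Pt d)) measurable_const

theorem measurableSet_origin_inter {g : Conf d → Pt d} (hg : Measurable g) (x : Pt d) :
    MeasurableSet {ω : Conf d | ω 0 = true ∧ g ω = x} :=
  measurableSet_origin.inter (hg (measurableSet_singleton x))

theorem setOf_Fps_eq_zero (g : Conf d → Pt d) (x : Pt d) :
    {ω : Conf d | ω x = true ∧ Fps g ω x = 0} =
      shift x ⁻¹' {ω : Conf d | ω 0 = true ∧ g ω = -x} := by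
  ext ω
  simp [shift, Fps, eq_neg_iff_add_eq_zero, add_comm]

theorem measurableSet_Fps_eq_zero {g : Conf d → Pt d} (hg : Measurable g) (x : Pt d) :
    MeasurableSet {ω : Conf d | ω x = true ∧ Fps g ω x = 0} := by
  rw [setOf_Fps_eq_zero]
  exact measurable_shift x (measurableSet_origin_inter hg (-x))

theorem measurable_inDegree {g : Conf d → Pt d} (hg : Measurable g) :
    Measurable (inDegree g) :=
  Measurable.tsum fun x => measurable_one.indicator (measurableSet_Fps_eq_zero hg x)

/-- Mass transport: the expected in-degree of the origin is the intensity. -/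
theorem lintegral_inDegree {μ : Measure (Conf d)} (hinv : ∀ t : Pt d, μ.map (shift t) = μ)
    {g : Conf d → Pt d} (hg : Measurable g) :
    ∫⁻ ω, inDegree g ω ∂μ = μ {ω : Conf d | ω 0 = true} := by
  calc ∫⁻ ω, inDegree g ω ∂μ
      = ∑' x : Pt d, μ {ω : Conf d | ω x = true ∧ Fps g ω x = 0} := by
        simp only [inDegree]
        rw [lintegral_tsum fun x =>
          (measurable_one.indicator (measurableSet_Fps_eq_zero hg x)).aemeasurable]
        exact tsum_congr fun x => lintegral_indicator_one (measurableSet_Fps_eq_zero hg x)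
    _ = ∑' x : Pt d, μ {ω : Conf d | ω 0 = true ∧ g ω = -x} := by
        refine tsum_congr fun x => ?_
        rw [setOf_Fps_eq_zero, ← Measure.map_apply (measurable_shift x)
          (measurableSet_origin_inter hg (-x)), hinv]
    _ = ∑' x : Pt d, μ {ω : Conf d | ω 0 = true ∧ g ω = x} :=
        (Equiv.neg (Pt d)).tsum_eq fun x => μ {ω : Conf d | ω 0 = true ∧ g ω = x}
    _ = μ (⋃ x : Pt d, {ω : Conf d | ω 0 = true ∧ g ω = x}) := by
        refine (measure_iUnion ?_ (measurableSet_origin_inter hg)).symm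
        intro x y hxy
        refine Set.disjoint_left.mpr ?_
        rintro ω ⟨-, rfl⟩ ⟨-, h⟩
        exact hxy h
    _ = μ {ω : Conf d | ω 0 = true} := by
        congr 1
        ext ω
        simp

theorem preimages_zero_eq_empty {g : Conf d → Pt d} (hg : IsPointMap g) {ω : Conf d}
    (h : ω 0 ≠ true) : preimages g ω 0 = ∅ := by
  refine Set.eq_empty_of_forall_notMem ?_
  rintro x ⟨hx, hx'⟩
  have := mapsTo_Fps hg ω hx
  rw [hx'] at this
  exact h this

/-- If almost surely the origin, when it is a point, has exactly one preimage, then the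
point-shift is almost surely bijective. -/
theorem ae_bijOn_of_inDegree {μ : Measure (Conf d)} (hinv : ∀ t : Pt d, μ.map (shift t) = μ)
    {g : Conf d → Pt d} (hg : IsPointMap g)
    (h : inDegree g =ᵐ[μ] {ω : Conf d | ω 0 = true}.indicator 1) :
    ∀ᵐ ω ∂μ, BijOn (Fps g ω) (pts ω) (pts ω) := by
  have hall : ∀ᵐ ω ∂μ, ∀ y : Pt d,
      inDegree g (shift y ω) = {ω : Conf d | ω 0 = true}.indicator 1 (shift y ω) :=
    ae_all_iff.mpr fun y =>
      (MeasurePreserving.mk (measurable_shift y) (hinv y)).quasiMeasurePreserving.ae h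
  filter_upwards [hall] with ω hω
  have key : ∀ y ∈ pts ω, ∃ x, preimages g ω y = {x} := by
    intro y hy
    have h1 := hω y
    rw [indicator_of_mem (by simpa [shift, pts] using hy), inDegree_eq_encard, preimages_shift,
      encard_preimage_of_bijective (AddGroup.addRight_bijective y), Pi.one_apply] at h1
    exact encard_eq_one.mp (by exact_mod_cast h1)
  refine ⟨mapsTo_Fps hg ω, ?_, ?_⟩
  · intro a ha b hb hab
    obtain ⟨x, hx⟩ := key _ (mapsTo_Fps hg ω hb)
    have hxa : a ∈ preimages g ω (Fps g ω b) := ⟨ha, hab⟩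
    have hxb : b ∈ preimages g ω (Fps g ω b) := ⟨hb, rfl⟩
    rw [hx] at hxa hxb
    exact hxa.trans hxb.symm
  · intro y hy
    obtain ⟨x, hx⟩ := key y hy
    have hxy : x ∈ preimages g ω y := hx ▸ mem_singleton x
    exact ⟨x, hxy⟩

theorem ae_bijOn_of_ae_injOn {μ : Measure (Conf d)} [IsFiniteMeasure μ]
    (hinv : ∀ t : Pt d, μ.map (shift t) = μ) {g : Conf d → Pt d} (hg : IsPointMap g)
    (h : ∀ᵐ ω ∂μ, InjOn (Fps g ω) (pts ω)) :
    ∀ᵐ ω ∂μ, BijOn (Fps g ω) (pts ω) (pts ω) := by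
  refine ae_bijOn_of_inDegree hinv hg (ae_eq_of_ae_le_of_lintegral_le ?_ ?_
    (measurable_one.indicator measurableSet_origin).aemeasurable ?_)
  · filter_upwards [h] with ω hω
    rw [inDegree_eq_encard]
    by_cases h0 : ω 0 = true
    · rw [indicator_of_mem (by exact h0), Pi.one_apply]
      exact_mod_cast (encard_le_one_iff (s := preimages g ω 0)).mpr
        fun a b ha hb => hω ha.1 hb.1 (ha.2.trans hb.2.symm)
    · simp [preimages_zero_eq_empty hg h0]
  · rw [lintegral_inDegree hinv hg.1]
    exact measure_ne_top _ _
  · rw [lintegral_inDegree hinv hg.1, lintegral_indicator_one measurableSet_origin]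

theorem ae_bijOn_of_ae_surjOn {μ : Measure (Conf d)} [IsFiniteMeasure μ]
    (hinv : ∀ t : Pt d, μ.map (shift t) = μ) {g : Conf d → Pt d} (hg : IsPointMap g)
    (h : ∀ᵐ ω ∂μ, SurjOn (Fps g ω) (pts ω) (pts ω)) :
    ∀ᵐ ω ∂μ, BijOn (Fps g ω) (pts ω) (pts ω) := by
  refine ae_bijOn_of_inDegree hinv hg (ae_eq_of_ae_le_of_lintegral_le ?_ ?_
    (measurable_inDegree hg.1).aemeasurable ?_).symm
  · filter_upwards [h] with ω hω
    rw [inDegree_eq_encard]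
    by_cases h0 : ω 0 = true
    · rw [indicator_of_mem (by exact h0), Pi.one_apply]
      exact_mod_cast (one_le_encard_iff_nonempty (s := preimages g ω 0)).mpr (hω h0)
    · rw [indicator_of_notMem (by exact h0)]
      exact zero_le
  · rw [lintegral_indicator_one measurableSet_origin]
    exact measure_ne_top _ _
  · rw [lintegral_inDegree hinv hg.1, lintegral_indicator_one measurableSet_origin]

end PointShift

/-- For every point-shift `F`: `F_ω` is almost surely injective on the
support of `ω` iff it is almost surely surjective onto it, and in either case it is
almost surely a bijection of the support. -/
theorem stmt_9 {d : ℕ} (hd : 0 < d)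
    (μ : Measure (PointShift.Conf d)) [IsProbabilityMeasure μ]
    (hinv : ∀ t : PointShift.Pt d, μ.map (PointShift.shift t) = μ)
    (hpos : 0 < μ {ω : PointShift.Conf d | ω 0 = true})
    (g : PointShift.Conf d → PointShift.Pt d) (hg : PointShift.IsPointMap g) :
    ((∀ᵐ ω ∂μ, Set.InjOn (PointShift.Fps g ω) (PointShift.pts ω)) ↔
      (∀ᵐ ω ∂μ, Set.SurjOn (PointShift.Fps g ω) (PointShift.pts ω) (PointShift.pts ω))) ∧
    ((∀ᵐ ω ∂μ, Set.InjOn (PointShift.Fps g ω) (PointShift.pts ω)) →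
      ∀ᵐ ω ∂μ, Set.BijOn (PointShift.Fps g ω) (PointShift.pts ω) (PointShift.pts ω)) ∧
    ((∀ᵐ ω ∂μ, Set.SurjOn (PointShift.Fps g ω) (PointShift.pts ω) (PointShift.pts ω)) →
      ∀ᵐ ω ∂μ, Set.BijOn (PointShift.Fps g ω) (PointShift.pts ω) (PointShift.pts ω)) := by
  have hi := PointShift.ae_bijOn_of_ae_injOn hinv hg
  have hs := PointShift.ae_bijOn_of_ae_surjOn hinv hg
  exact ⟨⟨fun h => (hi h).mono fun _ hω => hω.surjOn,
    fun h => (hs h).mono fun _ hω => hω.injOn⟩, hi, hs⟩
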